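/- arXiv:2508.04844 — 5 statements merged into one kernel-verified Lean document; each statement's English description precedes it below -/
import Mathlib

section
/- Let k ≥ 1 be an integer, fix parameters x, y, u, v ∈ ℂ, and let z, w ∈ ℂ∖ℝ with z ∉ {w, conj w}. Then the function ζ ↦ g_k(ζ, w) has at z the ℝ-Fréchet derivative ν ↦ ψ_k(z,w)(u,v)·(x − z·y)^{k}·ν − ψ_k(conj z, w)(u,v)·(x − conj(z)·y)^{k}·conj(ν), where ψ_k(z,w)(u,v) = Σ_{p+q=k, p,q≥0} ψ^{p,q}(z,w)·(u − w·v)^{p}·(u − conj(w)·v)^{q}. -/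
/- STATEMENT 13: The differential equation satisfied by the generating function
`g_k(z,w)`: its ℝ-Fréchet derivative with respect to `z` is
`ν ↦ ψ_k(z,w)(u,v)·(x − zy)^k·ν − ψ_k(conj z, w)(u,v)·(x − conj(z)y)^k·conj ν`. -/

open Complex ComplexConjugate

noncomputable section

/-- `ψ^{p,q}(z,w) = (w − conj w)/((z − w)^(p+1)·(z − conj w)^(q+1))`. -/
def psiPQ (p q : ℤ) (z w : ℂ) : ℂ :=
  (w - conj w) / ((z - w) ^ (p + 1) * (z - conj w) ^ (q + 1))

/-- The generating function `ψ_k(z,w)(u,v) = Σ_{p+q=k} ψ^{p,q}(z,w)·(u − wv)^p·(u − conj(w)v)^q`. -/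
def psiK (k : ℕ) (u v z w : ℂ) : ℂ :=
  ∑ p ∈ Finset.range (k + 1),
    psiPQ (p : ℤ) ((k - p : ℕ) : ℤ) z w * (u - w * v) ^ p * (u - conj w * v) ^ (k - p)

/-- `p_k(z,w) = −Σ_{p=1}^k (1/p)·((x − zy)(u − wv)/(z − w))^p·(vx − uy)^{k−p}`. -/
def pkF (k : ℕ) (x y u v z w : ℂ) : ℂ :=
  -(∑ p ∈ Finset.Icc 1 k, (1 / (p : ℂ)) *
      (((x - z * y) * (u - w * v)) / (z - w)) ^ p * (v * x - u * y) ^ (k - p))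

/-- The generating function `g_k(z,w)` of the higher Green's functions. -/
def gkF (k : ℕ) (x y u v z w : ℂ) : ℂ :=
  pkF k x y u v z w - pkF k x y u v z (conj w) - pkF k x y u v (conj z) w +
    pkF k x y u v (conj z) (conj w) +
    (v * x - u * y) ^ k *
      ((Real.log (Complex.normSq (z - w) / Complex.normSq (z - conj w)) : ℝ) : ℂ)

/-- The continuous ℝ-linear map `v ↦ a·v + b·conj v`. -/
def wirt (a b : ℂ) : ℂ →L[ℝ] ℂ :=
  a • (ContinuousLinearMap.id ℝ ℂ) + b • (Complex.conjCLE.toContinuousLinearMap)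

theorem wirt_apply (a b ν : ℂ) : wirt a b ν = a * ν + b * conj ν := by
  simp [wirt]

theorem HasDerivAt.hasFDerivAt_wirt {f : ℂ → ℂ} {f' z : ℂ} (h : HasDerivAt f f' z) :
    HasFDerivAt f (wirt f' 0) z := by
  refine (h.hasFDerivAt.restrictScalars ℝ).congr_fderiv ?_
  ext1 ν
  simp [wirt_apply, mul_comm]

theorem HasDerivAt.hasFDerivAt_wirt_comp_conj {f : ℂ → ℂ} {f' z : ℂ}
    (h : HasDerivAt f f' (conj z)) :
    HasFDerivAt (fun ζ => f (conj ζ)) (wirt 0 f') z := by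
  have hc : HasFDerivAt (fun ζ : ℂ => conj ζ) Complex.conjCLE.toContinuousLinearMap z :=
    Complex.conjCLE.toContinuousLinearMap.hasFDerivAt
  refine ((h.hasFDerivAt.restrictScalars ℝ).comp z hc).congr_fderiv ?_
  ext1 ν
  simp [wirt_apply, mul_comm]

theorem hasFDerivAt_log_normSq_sub {z w : ℂ} (h : z ≠ w) :
    HasFDerivAt (fun ζ : ℂ => ((Real.log (Complex.normSq (ζ - w)) : ℝ) : ℂ))
      (wirt (1 / (z - w)) (1 / (conj z - conj w))) z := by
  have h0 : z - w ≠ 0 := sub_ne_zero.2 h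
  have h0' : conj z - conj w ≠ 0 := by
    rw [← map_sub]
    exact (map_ne_zero _).2 h0
  have h1 : HasFDerivAt (fun ζ : ℂ => ‖ζ - w‖ ^ 2) _ z :=
    ((hasFDerivAt_id z).sub_const w).norm_sq
  simp only [← Complex.normSq_eq_norm_sq] at h1
  have h2 := Complex.ofRealCLM.hasFDerivAt.comp z
    (h1.log (by simpa [Complex.normSq_eq_zero] using h0))
  refine h2.congr_fderiv ?_
  ext1 ν
  have key : (2 * ((conj (z - w) * ν).re : ℝ) : ℂ) =
      conj (z - w) * ν + (z - w) * conj ν := by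
    have := Complex.add_conj (conj (z - w) * ν)
    simp only [map_mul, Complex.conj_conj] at this
    rw [this]
    push_cast
    ring
  have hn : ((Complex.normSq (z - w) : ℝ) : ℂ) = (z - w) * (conj z - conj w) := by
    rw [← map_sub, Complex.mul_conj]
  have hv : Complex.ofRealCLM.comp ((Complex.normSq (z - w))⁻¹ •
      (2 • (innerSL ℝ (z - w)).comp (ContinuousLinearMap.id ℝ ℂ))) ν =
      ((Complex.normSq (z - w) : ℝ) : ℂ)⁻¹ * (2 * ((conj (z - w) * ν).re : ℝ) : ℂ) := by
    simp [Complex.inner, mul_comm]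
    left
    ring
  refine hv.trans ?_
  rw [key, hn, wirt_apply, map_sub]
  field_simp

theorem hasDerivAt_pkF (k : ℕ) (x y u v : ℂ) {z w : ℂ} (h : z ≠ w) :
    HasDerivAt (fun ζ => pkF k x y u v ζ w)
      ((u - w * v) * (x - w * y) / (z - w) ^ 2 *
        ∑ p ∈ Finset.range k, ((x - z * y) * (u - w * v) / (z - w)) ^ p *
          (v * x - u * y) ^ (k - 1 - p)) z := by
  have h0 : z - w ≠ 0 := sub_ne_zero.2 h
  have hS : HasDerivAt (fun ζ => (x - ζ * y) * (u - w * v) / (ζ - w))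
      (-((u - w * v) * (x - w * y) / (z - w) ^ 2)) z := by
    have h1 := ((((hasDerivAt_id z).mul_const y).const_sub x).mul_const (u - w * v)).div
      ((hasDerivAt_id z).sub_const w) h0
    refine h1.congr_deriv ?_
    simp only [id]
    field_simp
    ring
  have hsum := (HasDerivAt.fun_sum (u := Finset.Icc 1 k) fun p _ =>
    ((hS.pow p).const_mul (1 / (p : ℂ))).mul_const ((v * x - u * y) ^ (k - p))).neg
  refine hsum.congr_deriv ?_
  have hI : Finset.Icc 1 k = Finset.Ico 1 (k + 1) := rfl
  rw [hI, Finset.sum_Ico_eq_sum_range, Finset.mul_sum, ← Finset.sum_neg_distrib]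
  refine Finset.sum_congr rfl fun p _ => ?_
  have hp : ((1 + p : ℕ) : ℂ) ≠ 0 := by exact_mod_cast (by omega : 1 + p ≠ 0)
  rw [show 1 + p - 1 = p by omega, show k - (1 + p) = k - 1 - p by omega, one_div]
  linear_combination ((u - w * v) * (x - w * y) / (z - w) ^ 2 *
    ((x - z * y) * (u - w * v) / (z - w)) ^ p * (v * x - u * y) ^ (k - 1 - p)) *
    inv_mul_cancel₀ hp

/-- With `a = v + c r` and `T = v A - c y`, the finite geometric sums telescope. -/
theorem geom_sum_sub_eq (k : ℕ) (A c v y r s : ℂ) :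
    ((v + c * r) * (A * r + y) * ∑ p ∈ Finset.range k,
        (A * (v + c * r)) ^ p * (v * A - c * y) ^ (k - 1 - p) + r * (v * A - c * y) ^ k) -
      ((v + c * s) * (A * s + y) * ∑ p ∈ Finset.range k,
        (A * (v + c * s)) ^ p * (v * A - c * y) ^ (k - 1 - p) + s * (v * A - c * y) ^ k) =
      (r - s) * (∑ p ∈ Finset.range (k + 1), (v + c * r) ^ p * (v + c * s) ^ (k - p)) *
        A ^ k := by
  by_cases hc : c = 0
  · subst hc
    have hg (t : ℂ) (n : ℕ) :
        ∑ p ∈ Finset.range n, t ^ p * t ^ (n - 1 - p) = n * t ^ (n - 1) := by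
      rw [Finset.sum_congr rfl fun p hp => show t ^ p * t ^ (n - 1 - p) = t ^ (n - 1) by
        rw [← pow_add, Nat.add_sub_cancel' (by have := Finset.mem_range.1 hp; omega)]]
      simp
    have h1 := hg (A * v) k
    have h2 := hg v (k + 1)
    simp only [add_tsub_cancel_right] at h2
    simp only [zero_mul, add_zero, sub_zero, mul_comm v A]
    rw [h1, h2]
    rcases k with _ | k
    · simp
    · simp only [add_tsub_cancel_right]
      push_cast
      ring
  · have h1 (r : ℂ) := (Commute.all (A * (v + c * r)) (v * A - c * y)).geom_sum₂_mul k
    have h2 := (Commute.all (v + c * r) (v + c * s)).geom_sum₂_mul (k + 1)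
    simp only [add_tsub_cancel_right] at h2
    apply mul_left_cancel₀ hc
    have h1r := h1 r
    have h1s := h1 s
    simp only [mul_pow A] at h1r h1s ⊢
    linear_combination (v + c * r) * h1r - (v + c * s) * h1s - A ^ k * h2

theorem psiK_eq (k : ℕ) (u v z w : ℂ) (h : z ≠ w) (h' : z ≠ conj w) :
    psiK k u v z w = (1 / (z - w) - 1 / (z - conj w)) *
      ∑ p ∈ Finset.range (k + 1), (v + (u - z * v) * (1 / (z - w))) ^ p *
        (v + (u - z * v) * (1 / (z - conj w))) ^ (k - p) := by
  have h0 := sub_ne_zero.2 h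
  have h0' := sub_ne_zero.2 h'
  have ha : v + (u - z * v) * (1 / (z - w)) = (u - w * v) / (z - w) := by
    field_simp
    ring
  have hb : v + (u - z * v) * (1 / (z - conj w)) = (u - conj w * v) / (z - conj w) := by
    field_simp
    ring
  rw [psiK, ha, hb, Finset.mul_sum]
  refine Finset.sum_congr rfl fun p _ => ?_
  rw [psiPQ, div_pow, div_pow]
  norm_cast
  rw [pow_succ, pow_succ]
  field_simp
  ring

theorem deriv_pkF_sub_eq (k : ℕ) (x y u v z w : ℂ) (h : z ≠ w) (h' : z ≠ conj w) :
    ((u - w * v) * (x - w * y) / (z - w) ^ 2 *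
        ∑ p ∈ Finset.range k, ((x - z * y) * (u - w * v) / (z - w)) ^ p *
          (v * x - u * y) ^ (k - 1 - p) + 1 / (z - w) * (v * x - u * y) ^ k) -
      ((u - conj w * v) * (x - conj w * y) / (z - conj w) ^ 2 *
        ∑ p ∈ Finset.range k, ((x - z * y) * (u - conj w * v) / (z - conj w)) ^ p *
          (v * x - u * y) ^ (k - 1 - p) + 1 / (z - conj w) * (v * x - u * y) ^ k) =
      psiK k u v z w * (x - z * y) ^ k := by
  have h1 (t : ℂ) (ht : z ≠ t) : (u - t * v) * (x - t * y) / (z - t) ^ 2 =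
      (v + (u - z * v) * (1 / (z - t))) * ((x - z * y) * (1 / (z - t)) + y) := by
    have := sub_ne_zero.2 ht
    field_simp
    ring
  have h2 (t : ℂ) (ht : z ≠ t) : (x - z * y) * (u - t * v) / (z - t) =
      (x - z * y) * (v + (u - z * v) * (1 / (z - t))) := by
    have := sub_ne_zero.2 ht
    field_simp
    ring
  have h3 : v * x - u * y = v * (x - z * y) - (u - z * v) * y := by ring
  rw [h1 w h, h1 _ h', h2 w h, h2 _ h', h3, psiK_eq k u v z w h h']
  exact geom_sum_sub_eq k (x - z * y) (u - z * v) v y _ _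

theorem statement_13 (k : ℕ) (hk : 1 ≤ k) (x y u v : ℂ) (z w : ℂ)
    (hz : z.im ≠ 0) (hw : w.im ≠ 0) (hzw : z ≠ w) (hzwc : z ≠ conj w) :
    HasFDerivAt (fun ζ : ℂ => gkF k x y u v ζ w)
      (wirt (psiK k u v z w * (x - z * y) ^ k)
        (-(psiK k u v (conj z) w) * (x - conj z * y) ^ k)) z := by
  have hc : conj z ≠ w := fun h => hzwc (by rw [← h, Complex.conj_conj])
  have hcc : conj z ≠ conj w := fun h => hzw (star_injective h)
  have hlog : HasFDerivAt
      (fun ζ : ℂ => ((Real.log (Complex.normSq (ζ - w) / Complex.normSq (ζ - conj w)) : ℝ) : ℂ))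
      (wirt (1 / (z - w)) (1 / (conj z - conj w)) -
        wirt (1 / (z - conj w)) (1 / (conj z - conj (conj w)))) z := by
    refine ((hasFDerivAt_log_normSq_sub hzw).sub
      (hasFDerivAt_log_normSq_sub hzwc)).congr_of_eventuallyEq ?_
    filter_upwards [isOpen_ne.mem_nhds hzw, isOpen_ne.mem_nhds hzwc] with ζ h1 h2
    rw [Real.log_div (by simpa [sub_eq_zero] using h1) (by simpa [sub_eq_zero] using h2)]
    simp
  have hg := ((((hasDerivAt_pkF k x y u v hzw).hasFDerivAt_wirt.sub
    (hasDerivAt_pkF k x y u v hzwc).hasFDerivAt_wirt).sub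
    (hasDerivAt_pkF k x y u v hc).hasFDerivAt_wirt_comp_conj).add
    (hasDerivAt_pkF k x y u v hcc).hasFDerivAt_wirt_comp_conj).add
    (hlog.const_mul ((v * x - u * y) ^ k))
  refine hg.congr_fderiv ?_
  ext1 ν
  simp only [add_apply, sub_apply, smul_apply, wirt_apply, smul_eq_mul, Complex.conj_conj,
    neg_mul, ← deriv_pkF_sub_eq k x y u v z w hzw hzwc,
    ← deriv_pkF_sub_eq k x y u v (conj z) w hc hcc]
  ring
end
end

section
/- Let Γ be a finite-index subgroup of SL₂(ℤ) and k ≥ 1 an integer. For every compact subset K ⊆ ℍ × ℍ there exists a finite subset S ⊆ Γ such that γ·z ≠ w for all γ ∈ Γ∖S and all (z,w) ∈ K, and the family (γ ∈ Γ∖S) ↦ sup_{(z,w)∈K} |j_γ(z)^{−k}·(γ·z − w)^{−k}·𝓛_k(x(γ·z, w))| is summable. -/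
/- STATEMENT 14: Normal convergence of the higher Green's function series on
compact subsets of `ℍ × ℍ`: the corner components
`j_γ(z)^{−k}·(γ·z − w)^{−k}·𝓛_k(x(γ·z, w))` converge normally. -/

open Complex ComplexConjugate

noncomputable section

abbrev SL2Z := Matrix.SpecialLinearGroup (Fin 2) ℤ

/-- The real matrix associated to an element of `SL₂(ℤ)`. -/
def toRealM (γ : SL2Z) : Matrix (Fin 2) (Fin 2) ℝ :=
  γ.val.map fun n => (n : ℝ)

/-- Automorphy factor `j_γ(z) = c·z + d` for a real matrix `γ = (a, b; c, d)`. -/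
def jFac (γ : Matrix (Fin 2) (Fin 2) ℝ) (z : ℂ) : ℂ :=
  ((γ 1 0 : ℝ) : ℂ) * z + ((γ 1 1 : ℝ) : ℂ)

/-- Möbius action `γ·z = (a·z + b)/(c·z + d)`. -/
def moeb (γ : Matrix (Fin 2) (Fin 2) ℝ) (z : ℂ) : ℂ :=
  (((γ 0 0 : ℝ) : ℂ) * z + ((γ 0 1 : ℝ) : ℂ)) / (((γ 1 0 : ℝ) : ℂ) * z + ((γ 1 1 : ℝ) : ℂ))

/-- The truncated logarithm `𝓛_k(x) = −Σ_{p=1}^k x^{p−k}/p − x^{−k}·log(1−x)`. -/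
def Lrem (k : ℕ) (x : ℝ) : ℝ :=
  -(∑ p ∈ Finset.Icc 1 k, x ^ ((p : ℤ) - (k : ℤ)) / (p : ℝ)) -
    x ^ (-(k : ℤ)) * Real.log (1 - x)

/-- `x(z,w) = −4·Im(z)·Im(w)/|z−w|²`. -/
def xCross (z w : ℂ) : ℝ :=
  (-(4 * z.im * w.im)) / Complex.normSq (z - w)

/-- The squared Frobenius norm of a real `2 × 2` matrix. -/
def frobSq (γ : Matrix (Fin 2) (Fin 2) ℝ) : ℝ :=
  γ 0 0 ^ 2 + γ 0 1 ^ 2 + γ 1 0 ^ 2 + γ 1 1 ^ 2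

lemma abs_sum_add_log_one_sub_le (k : ℕ) {x : ℝ} (hx : x < 0) :
    |(∑ i ∈ Finset.range k, x ^ (i + 1) / ((i : ℝ) + 1)) + Real.log (1 - x)| ≤ |x| ^ (k + 1) := by
  set F : ℝ → ℝ := fun y => (∑ i ∈ Finset.range k, y ^ (i + 1) / ((i : ℝ) + 1)) + Real.log (1 - y)
    with hF
  have hderiv : ∀ y ∈ Set.Icc x 0, HasDerivWithinAt F (-y ^ k / (1 - y)) (Set.Icc x 0) y := by
    intro y hy
    have hy1 : 1 - y ≠ 0 := by linarith [hy.2]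
    have hy2 : y ≠ 1 := by intro h; apply hy1; linarith
    have : HasDerivAt F ((∑ i ∈ Finset.range k, ((i + 1 : ℕ) * y ^ i) / ((i : ℝ) + 1)) +
        (-1) / (1 - y)) y :=
      .add (.fun_sum fun i _ => (hasDerivAt_pow (i + 1) y).div_const ((i : ℝ) + 1))
        (((hasDerivAt_id y).const_sub _).log hy1)
    convert! this.hasDerivWithinAt using 1
    calc -y ^ k / (1 - y) = (∑ i ∈ Finset.range k, y ^ i) + (-1) / (1 - y) := by
          rw [geom_sum_eq hy2]
          have : y - 1 ≠ 0 := sub_ne_zero.2 hy2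
          field_simp
          ring
      _ = _ := by
          congr with i
          have : (i : ℝ) + 1 ≠ 0 := by positivity
          push_cast
          field_simp
  have hbound : ∀ y ∈ Set.Icc x 0, ‖-y ^ k / (1 - y)‖ ≤ |x| ^ k := by
    intro y hy
    have h1 : 1 ≤ |1 - y| := (le_abs_self _).trans' (by linarith [hy.2])
    rw [Real.norm_eq_abs, abs_div, abs_neg, abs_pow]
    refine (div_le_self (by positivity) h1).trans ?_
    gcongr 1
    rw [abs_of_nonpos hy.2, abs_of_neg hx]
    linarith [hy.1]
  have h := (convex_Icc x 0).norm_image_sub_le_of_norm_hasDerivWithin_le hderiv hbound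
    (Set.right_mem_Icc.2 hx.le) (Set.left_mem_Icc.2 hx.le)
  have h0 : F 0 = 0 := by simp [hF]
  rw [h0, sub_zero, sub_zero, Real.norm_eq_abs, Real.norm_eq_abs, ← pow_succ] at h
  exact h

lemma abs_Lrem_le (k : ℕ) {x : ℝ} (hx : x < 0) : |Lrem k x| ≤ |x| := by
  have hL : Lrem k x = -(((∑ i ∈ Finset.range k, x ^ (i + 1) / ((i : ℝ) + 1)) +
      Real.log (1 - x)) / x ^ k) := by
    have hsum : ∑ p ∈ Finset.Icc 1 k, x ^ ((p : ℤ) - (k : ℤ)) / (p : ℝ) =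
        (∑ i ∈ Finset.range k, x ^ (i + 1) / ((i : ℝ) + 1)) / x ^ k := by
      rw [Finset.sum_div, Finset.range_eq_Ico, show Finset.Icc 1 k = Finset.Ico (0 + 1) (k + 1) from
        rfl, ← Finset.sum_Ico_add']
      refine Finset.sum_congr rfl fun i _ => ?_
      rw [zpow_sub₀ hx.ne, zpow_natCast, zpow_natCast, div_right_comm]
      push_cast
      rfl
    rw [Lrem, hsum, zpow_neg, zpow_natCast]
    ring
  have hx' : 0 < |x| := abs_pos.2 hx.ne
  rw [hL, abs_neg, abs_div, abs_pow, div_le_iff₀ (by positivity), ← pow_succ']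
  exact abs_sum_add_log_one_sub_le k hx

lemma sq_add_sq_le_normSq {M ε : ℝ} (hε : 0 < ε) {z : ℂ} (hz : ‖z‖ ≤ M) (hzε : ε ≤ z.im)
    (c d : ℝ) : c ^ 2 + d ^ 2 ≤ (2 + (1 + 2 * M ^ 2) / ε ^ 2) * ‖(c : ℂ) * z + d‖ ^ 2 := by
  have hre : z.re ^ 2 ≤ M ^ 2 := sq_le_sq' (by linarith [neg_abs_le z.re, abs_re_le_norm z])
    ((le_abs_self _).trans ((abs_re_le_norm z).trans hz))
  have hQ : ‖(c : ℂ) * z + d‖ ^ 2 = (c * z.re + d) ^ 2 + c ^ 2 * z.im ^ 2 := by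
    rw [← normSq_eq_norm_sq, normSq_apply]
    simp
    ring
  have hc : c ^ 2 ≤ ‖(c : ℂ) * z + d‖ ^ 2 / ε ^ 2 := by
    rw [le_div_iff₀ (by positivity), hQ]
    have : c ^ 2 * ε ^ 2 ≤ c ^ 2 * z.im ^ 2 := by gcongr
    nlinarith [sq_nonneg (c * z.re + d)]
  have hd : d ^ 2 ≤ 2 * ‖(c : ℂ) * z + d‖ ^ 2 + 2 * (M ^ 2 * c ^ 2) := by
    have : z.re ^ 2 * c ^ 2 ≤ M ^ 2 * c ^ 2 := by gcongr
    nlinarith [sq_nonneg (c * z.re + d + c * z.re), sq_nonneg (c * z.im)]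
  calc c ^ 2 + d ^ 2 ≤ (1 + 2 * M ^ 2) * c ^ 2 + 2 * ‖(c : ℂ) * z + d‖ ^ 2 := by linarith
    _ ≤ (1 + 2 * M ^ 2) * (‖(c : ℂ) * z + d‖ ^ 2 / ε ^ 2) + 2 * ‖(c : ℂ) * z + d‖ ^ 2 := by gcongr
    _ = _ := by ring

/-- On a compact set of pairs `(z, w)`, `j_γ(z)·(γ·z − w)` grows like the norm of `γ`. -/
lemma exists_sqrt_frobSq_le {M ε : ℝ} (hM : 0 ≤ M) (hε : 0 < ε) :
    ∃ C : ℝ, 0 < C ∧ ∀ (γ : Matrix (Fin 2) (Fin 2) ℝ), γ.det = 1 → ∀ z w : ℂ,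
      ‖z‖ ≤ M → ‖w‖ ≤ M → ε ≤ z.im → ε ≤ w.im →
      √(frobSq γ) ≤ C * (‖(γ 0 0 : ℂ) * z + γ 0 1 - w * jFac γ z‖ + 1) := by
  set L := 2 + (1 + 2 * M ^ 2) / ε ^ 2 with hL
  set q := (1 + M) / ε with hq
  have hLpos : 0 < L := by positivity
  have hqpos : 0 < q := by positivity
  refine ⟨√(L * ((1 + M * q) ^ 2 + q ^ 2)), by positivity, fun γ hγ z w hz hw hzε hwε => ?_⟩
  rw [Matrix.det_fin_two] at hγ
  have hP := sq_add_sq_le_normSq hε hz hzε (γ 0 0) (γ 0 1)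
  have hQ := sq_add_sq_le_normSq hε hz hzε (γ 1 0) (γ 1 1)
  change _ ≤ L * ‖jFac γ z‖ ^ 2 at hQ
  have hjre : (jFac γ z).re = γ 1 0 * z.re + γ 1 1 := by simp [jFac]
  have hjim : (jFac γ z).im = γ 1 0 * z.im := by simp [jFac]
  set P := (γ 0 0 : ℂ) * z + γ 0 1 with hPdef
  have hPre : P.re = γ 0 0 * z.re + γ 0 1 := by simp [P]
  have hPim : P.im = γ 0 0 * z.im := by simp [P]
  set Q := jFac γ z
  set A := P - w * Q with hA
  set B := P - conj w * Q with hB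
  have hBA : ‖B‖ ^ 2 = ‖A‖ ^ 2 + 4 * (z.im * w.im) := by
    rw [← normSq_eq_norm_sq, ← normSq_eq_norm_sq, normSq_apply, normSq_apply, hA, hB]
    simp only [sub_re, sub_im, mul_re, mul_im, conj_re, conj_im, hPre, hPim, hjre, hjim]
    linear_combination (4 * z.im * w.im) * hγ
  have hzM : z.im ≤ M := (le_abs_self _).trans ((abs_im_le_norm z).trans hz)
  have hwM : w.im ≤ M := (le_abs_self _).trans ((abs_im_le_norm w).trans hw)
  have hBle : ‖B‖ ≤ ‖A‖ + 2 * M := by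
    refine (sq_le_sq₀ (norm_nonneg _) (by positivity)).1 ?_
    have : z.im * w.im ≤ M * M := mul_le_mul hzM hwM (by linarith) hM
    nlinarith [norm_nonneg A]
  have hQle : ‖Q‖ ≤ q * (‖A‖ + 1) := by
    have h1 : B - A = (2 * w.im : ℝ) * I * Q := by
      rw [← sub_conj]
      ring
    have h2 : 2 * w.im * ‖Q‖ ≤ ‖B‖ + ‖A‖ := by
      have := norm_sub_le B A
      rwa [h1, norm_mul, norm_mul, norm_I, mul_one, norm_real, Real.norm_of_nonneg (by linarith)]
        at this
    have h3 : ε * ‖Q‖ ≤ w.im * ‖Q‖ := by gcongr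
    rw [hq, div_mul_eq_mul_div, le_div_iff₀ hε]
    nlinarith [norm_nonneg A, mul_nonneg hM (norm_nonneg A)]
  have hPle : ‖P‖ ≤ (1 + M * q) * (‖A‖ + 1) := by
    have h1 : ‖P‖ ≤ ‖A‖ + ‖w‖ * ‖Q‖ := by
      rw [← norm_mul]
      have : P = A + w * Q := by rw [hA]; ring
      rw [this]
      exact norm_add_le _ _
    have h2 : ‖w‖ * ‖Q‖ ≤ M * (q * (‖A‖ + 1)) := by gcongr
    linarith
  have hN : frobSq γ ≤ L * ((1 + M * q) ^ 2 + q ^ 2) * (‖A‖ + 1) ^ 2 := by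
    calc frobSq γ ≤ L * ‖P‖ ^ 2 + L * ‖Q‖ ^ 2 := by rw [frobSq]; linarith
      _ ≤ L * ((1 + M * q) * (‖A‖ + 1)) ^ 2 + L * (q * (‖A‖ + 1)) ^ 2 := by gcongr
      _ = _ := by ring
  refine (Real.sqrt_le_sqrt hN).trans_eq ?_
  rw [Real.sqrt_mul (by positivity), Real.sqrt_sq (by positivity)]

/-- The bottom row of `γ` together with the integer part of `Re (γ·i)`. -/
def rowAndShift (γ : SL2Z) : (Fin 2 → ℤ) × ℤ :=
  (γ.val 1, (γ.val 0 0 * γ.val 1 0 + γ.val 0 1 * γ.val 1 1) / (γ.val 1 0 ^ 2 + γ.val 1 1 ^ 2))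

lemma bottom_row_sq_pos (γ : SL2Z) : 0 < γ.val 1 0 ^ 2 + γ.val 1 1 ^ 2 := by
  have hdet := γ.det_coe
  rw [Matrix.det_fin_two] at hdet
  by_contra! h
  have h0 : γ.val 1 0 = 0 := by nlinarith [sq_nonneg (γ.val 1 0), sq_nonneg (γ.val 1 1)]
  have h1 : γ.val 1 1 = 0 := by nlinarith [sq_nonneg (γ.val 1 0), sq_nonneg (γ.val 1 1)]
  simp [h0, h1] at hdet

lemma rowAndShift_injective : Function.Injective rowAndShift := by
  intro γ δ h
  have hq := bottom_row_sq_pos γ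
  have hγ := γ.det_coe
  have hδ := δ.det_coe
  rw [Matrix.det_fin_two] at hγ hδ
  simp only [rowAndShift, Prod.mk.injEq] at h
  obtain ⟨hrow, hn⟩ := h
  have hc : δ.val 1 0 = γ.val 1 0 := (congrFun hrow 0).symm
  have hd : δ.val 1 1 = γ.val 1 1 := (congrFun hrow 1).symm
  rw [hc, hd] at hn hδ
  have htop : δ.val 0 0 = γ.val 0 0 ∧ δ.val 0 1 = γ.val 0 1 := by
    generalize γ.val 0 0 = a, γ.val 0 1 = b, γ.val 1 0 = c, γ.val 1 1 = d,
      δ.val 0 0 = a', δ.val 0 1 = b' at *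
    obtain ⟨m, hma, hmb⟩ : ∃ m, a' = a + m * c ∧ b' = b + m * d := by
      refine ⟨a * b' - a' * b, ?_, ?_⟩
      · linear_combination a * hδ - a' * hγ
      · linear_combination b * hδ - b' * hγ
    have he : a' * c + b' * d = a * c + b * d + m * (c ^ 2 + d ^ 2) := by
      rw [hma, hmb]; ring
    rw [he, Int.add_mul_ediv_right _ _ hq.ne'] at hn
    have hm : m = 0 := by linarith
    simp [hma, hmb, hm]
  ext i j
  fin_cases i <;> fin_cases j <;> simp [htop.1, htop.2, hc, hd]

lemma rowAndShift_sq_le (γ : SL2Z) :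
    ((γ.val 1 0 ^ 2 + γ.val 1 1 ^ 2 : ℤ) : ℝ) * (1 + ((rowAndShift γ).2 : ℝ) ^ 2) ≤
      3 * frobSq (toRealM γ) := by
  have hq := bottom_row_sq_pos γ
  have hdet := γ.det_coe
  rw [Matrix.det_fin_two] at hdet
  simp only [rowAndShift, frobSq, toRealM, Matrix.map_apply]
  norm_cast
  generalize γ.val 0 0 = a, γ.val 0 1 = b, γ.val 1 0 = c, γ.val 1 1 = d at *
  have hr := Int.mul_ediv_add_emod (a * c + b * d) (c ^ 2 + d ^ 2)
  have hr0 := Int.emod_nonneg (a * c + b * d) hq.ne'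
  have hr1 := Int.emod_lt_of_pos (a * c + b * d) hq
  generalize (a * c + b * d) / (c ^ 2 + d ^ 2) = n at *
  generalize (a * c + b * d) % (c ^ 2 + d ^ 2) = r at *
  have hpq : (a ^ 2 + b ^ 2) * (c ^ 2 + d ^ 2) = (a * c + b * d) ^ 2 + 1 := by
    linear_combination (a * d - b * c + 1) * hdet
  refine le_of_mul_le_mul_left ?_ hq
  rw [← hr] at hpq
  rw [add_assoc (a ^ 2 + b ^ 2)]
  generalize c ^ 2 + d ^ 2 = q at *
  have hrq : r ^ 2 ≤ q ^ 2 := by gcongr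
  nlinarith [sq_nonneg (q * n + 2 * r)]

lemma summable_inv_frob_cube :
    Summable fun γ : SL2Z => (√(frobSq (toRealM γ)) ^ 3)⁻¹ := by
  have h1 : Summable fun v : Fin 2 → ℤ => ‖v‖ ^ (-(3 : ℝ)) :=
    EisensteinSeries.summable_one_div_norm_rpow (by norm_num)
  have h2 : Summable fun n : ℤ => (1 + (n : ℝ) ^ 2)⁻¹ := by
    refine .of_norm_bounded_eventually (Real.summable_one_div_int_pow.2 one_lt_two) ?_
    filter_upwards [(Set.finite_singleton (0 : ℤ)).compl_mem_cofinite] with n hn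
    have : (0 : ℝ) < (n : ℝ) ^ 2 := by
      have : (n : ℝ) ≠ 0 := by exact_mod_cast hn
      positivity
    rw [Real.norm_of_nonneg (by positivity), one_div]
    gcongr
    linarith
  have h3 := ((h1.mul_of_nonneg h2 (fun _ => by positivity) (fun _ => by positivity)).comp_injective
    rowAndShift_injective).mul_left 3
  refine .of_nonneg_of_le (fun _ => by positivity) (fun γ => ?_) h3
  have hq := bottom_row_sq_pos γ
  have hN := rowAndShift_sq_le γ
  have hq' : (0 : ℝ) < ((γ.val 1 0 ^ 2 + γ.val 1 1 ^ 2 : ℤ) : ℝ) := by exact_mod_cast hq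
  have hv : ‖(rowAndShift γ).1‖ ^ 2 ≤ ((γ.val 1 0 ^ 2 + γ.val 1 1 ^ 2 : ℤ) : ℝ) := by
    rw [← Real.le_sqrt (norm_nonneg _) hq'.le, pi_norm_le_iff_of_nonneg (Real.sqrt_nonneg _)]
    intro i
    refine Real.le_sqrt_of_sq_le ?_
    rw [Int.norm_eq_abs, sq_abs]
    push_cast
    fin_cases i <;> simp [rowAndShift, sq_nonneg]
  have hvpos : 0 < ‖(rowAndShift γ).1‖ := by
    rw [norm_pos_iff]
    intro h
    simp [show γ.val 1 = 0 from h] at hq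
  have hqN : ((γ.val 1 0 ^ 2 + γ.val 1 1 ^ 2 : ℤ) : ℝ) ≤ frobSq (toRealM γ) := by
    simp only [frobSq, toRealM, Matrix.map_apply]
    push_cast
    nlinarith [sq_nonneg (γ.val 0 0 : ℝ), sq_nonneg (γ.val 0 1 : ℝ)]
  have hs2 : √(frobSq (toRealM γ)) ^ 2 = frobSq (toRealM γ) := Real.sq_sqrt (by linarith)
  have hvs : ‖(rowAndShift γ).1‖ ≤ √(frobSq (toRealM γ)) := Real.le_sqrt_of_sq_le (by linarith)
  simp only [Function.comp_apply]
  rw [Real.rpow_neg hvpos.le, show (3 : ℝ) = ((3 : ℕ) : ℝ) by norm_num, Real.rpow_natCast,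
    ← mul_inv]
  set t := ‖(rowAndShift γ).1‖
  set s := √(frobSq (toRealM γ))
  set n : ℝ := ((rowAndShift γ).2 : ℝ)
  have hs : 0 < s := hvpos.trans_le hvs
  have key : t ^ 3 * (1 + n ^ 2) ≤ 3 * s ^ 3 := by
    calc t ^ 3 * (1 + n ^ 2) = t * (t ^ 2 * (1 + n ^ 2)) := by ring
      _ ≤ s * (3 * s ^ 2) := by
          have : t ^ 2 * (1 + n ^ 2) ≤ 3 * s ^ 2 := by
            rw [hs2]
            exact hN.trans' (by gcongr)
          gcongr
      _ = _ := by ring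
  rw [← div_eq_mul_inv, inv_eq_one_div, div_le_div_iff₀ (by positivity) (by positivity)]
  push_cast
  linarith

lemma det_toRealM (γ : SL2Z) : (toRealM γ).det = 1 := by
  have hdet := γ.det_coe
  rw [Matrix.det_fin_two] at hdet ⊢
  simp only [toRealM, Matrix.map_apply]
  exact_mod_cast hdet

lemma moeb_im_mul_normSq {γ : Matrix (Fin 2) (Fin 2) ℝ} (hγ : γ.det = 1) {z : ℂ}
    (hj : jFac γ z ≠ 0) : (moeb γ z).im * ‖jFac γ z‖ ^ 2 = z.im := by
  have hn : normSq (jFac γ z) ≠ 0 := by simpa using hj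
  rw [Matrix.det_fin_two] at hγ
  rw [← normSq_eq_norm_sq, moeb, ← jFac, div_im]
  field_simp
  simp [jFac]
  linear_combination z.im * hγ

lemma jFac_ne_zero {γ : Matrix (Fin 2) (Fin 2) ℝ} (hγ : γ.det = 1) {z : ℂ} (hz : 0 < z.im) :
    jFac γ z ≠ 0 := by
  intro h
  rw [Matrix.det_fin_two] at hγ
  have him : γ 1 0 * z.im = 0 := by simpa [jFac] using congrArg im h
  have hc : γ 1 0 = 0 := by simpa [hz.ne'] using him
  have hd : γ 1 1 = 0 := by simpa [jFac, hc] using congrArg re h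
  simp [hc, hd] at hγ

lemma jFac_mul_moeb_sub {γ : Matrix (Fin 2) (Fin 2) ℝ} {z : ℂ} (hj : jFac γ z ≠ 0) (w : ℂ) :
    jFac γ z * (moeb γ z - w) = (γ 0 0 : ℂ) * z + γ 0 1 - w * jFac γ z := by
  rw [mul_sub, moeb, ← jFac, mul_div_cancel₀ _ hj]
  ring

lemma norm_green_corner_le {γ : Matrix (Fin 2) (Fin 2) ℝ} (hγ : γ.det = 1) (k : ℕ) {z w : ℂ}
    (hz : 0 < z.im) (hw : 0 < w.im) (hzw : moeb γ z ≠ w) :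
    ‖jFac γ z ^ (-(k : ℤ)) * (moeb γ z - w) ^ (-(k : ℤ)) *
      ((Lrem k (xCross (moeb γ z) w) : ℝ) : ℂ)‖ ≤
      4 * z.im * w.im / ‖jFac γ z * (moeb γ z - w)‖ ^ (k + 2) := by
  have hj := jFac_ne_zero hγ hz
  have hjn : 0 < ‖jFac γ z‖ := norm_pos_iff.2 hj
  have hmn : 0 < ‖moeb γ z - w‖ := norm_pos_iff.2 (sub_ne_zero.2 hzw)
  have him := moeb_im_mul_normSq hγ hj
  have himpos : 0 < (moeb γ z).im := by
    by_contra! h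
    nlinarith [sq_nonneg ‖jFac γ z‖]
  have hx : xCross (moeb γ z) w = -(4 * (moeb γ z).im * w.im / ‖moeb γ z - w‖ ^ 2) := by
    rw [xCross, normSq_eq_norm_sq, neg_div]
  have hpos : 0 < 4 * (moeb γ z).im * w.im / ‖moeb γ z - w‖ ^ 2 := by positivity
  have hL := abs_Lrem_le k (x := xCross (moeb γ z) w) (by rw [hx]; linarith)
  rw [hx, abs_neg, abs_of_pos hpos, ← hx] at hL
  rw [← mul_zpow, norm_mul, norm_zpow, norm_real, Real.norm_eq_abs, zpow_neg, zpow_natCast]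
  refine (mul_le_mul_of_nonneg_left hL (by positivity)).trans_eq ?_
  rw [norm_mul, ← him]
  field_simp
  ring

lemma exists_bounds_of_isCompact {K : Set (ℂ × ℂ)} (hK : IsCompact K)
    (hKH : K ⊆ {p : ℂ × ℂ | 0 < p.1.im ∧ 0 < p.2.im}) :
    ∃ M ε : ℝ, 0 ≤ M ∧ 0 < ε ∧
      ∀ p ∈ K, ‖p.1‖ ≤ M ∧ ‖p.2‖ ≤ M ∧ ε ≤ p.1.im ∧ ε ≤ p.2.im := by
  obtain ⟨M, hM0, hM⟩ := hK.isBounded.exists_pos_norm_le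
  obtain ⟨ε, hε, hεK⟩ := hK.exists_forall_le' (f := fun p : ℂ × ℂ => min p.1.im p.2.im) (a := 0)
    (by fun_prop) (fun p hp => lt_min (hKH hp).1 (hKH hp).2)
  exact ⟨M, ε, hM0.le, hε, fun p hp => ⟨(norm_fst_le p).trans (hM p hp),
    (norm_snd_le p).trans (hM p hp), (hεK p hp).trans (min_le_left _ _),
    (hεK p hp).trans (min_le_right _ _)⟩⟩

theorem statement_14
    (Γ : Subgroup SL2Z) (hΓ : Γ.FiniteIndex) (k : ℕ) (hk : 1 ≤ k)
    (K : Set (ℂ × ℂ)) (hK : IsCompact K)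
    (hKH : K ⊆ {p : ℂ × ℂ | 0 < p.1.im ∧ 0 < p.2.im}) :
    ∃ S : Finset Γ,
      (∀ γ : Γ, γ ∉ S → ∀ p ∈ K, moeb (toRealM ↑γ) p.1 ≠ p.2) ∧
      Summable (fun γ : {γ : Γ // γ ∉ S} =>
        ⨆ p : K, ‖jFac (toRealM ↑(γ.1)) (p : ℂ × ℂ).1 ^ (-(k : ℤ)) *
          (moeb (toRealM ↑(γ.1)) (p : ℂ × ℂ).1 - (p : ℂ × ℂ).2) ^ (-(k : ℤ)) *
          ((Lrem k (xCross (moeb (toRealM ↑(γ.1)) (p : ℂ × ℂ).1) (p : ℂ × ℂ).2) : ℝ) : ℂ)‖) := by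
  obtain ⟨M, ε, hM, hε, hb⟩ := exists_bounds_of_isCompact hK hKH
  obtain ⟨C, hC, hCb⟩ := exists_sqrt_frobSq_le hM hε
  have hsum : Summable fun γ : Γ => (√(frobSq (toRealM (γ : SL2Z))) ^ 3)⁻¹ :=
    summable_inv_frob_cube.comp_injective Subtype.val_injective
  have hfin : {γ : Γ | ¬ (√(frobSq (toRealM (γ : SL2Z))) ^ 3)⁻¹ < ((2 * C) ^ 3)⁻¹}.Finite :=
    hsum.tendsto_cofinite_zero.eventually_lt_const (by positivity)
  have hlower : ∀ γ : Γ, γ ∉ hfin.toFinset → ∀ p ∈ K,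
      1 ≤ ‖jFac (toRealM (γ : SL2Z)) p.1 * (moeb (toRealM (γ : SL2Z)) p.1 - p.2)‖ ∧
      √(frobSq (toRealM (γ : SL2Z))) ≤
        2 * C * ‖jFac (toRealM (γ : SL2Z)) p.1 * (moeb (toRealM (γ : SL2Z)) p.1 - p.2)‖ ∧
      0 < √(frobSq (toRealM (γ : SL2Z))) := by
    intro γ hγ p hp
    obtain ⟨h1, h2, h3, h4⟩ := hb p hp
    have hdet := det_toRealM γ
    have hs : 0 < √(frobSq (toRealM (γ : SL2Z))) := by
      rw [Real.sqrt_pos]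
      have h := bottom_row_sq_pos (γ : SL2Z)
      have h' : (0 : ℝ) < ((γ : SL2Z).val 1 0 : ℝ) ^ 2 + ((γ : SL2Z).val 1 1 : ℝ) ^ 2 := by
        exact_mod_cast h
      simp only [frobSq, toRealM, Matrix.map_apply]
      nlinarith [sq_nonneg ((γ : SL2Z).val 0 0 : ℝ), sq_nonneg ((γ : SL2Z).val 0 1 : ℝ)]
    have hlt : 2 * C < √(frobSq (toRealM (γ : SL2Z))) := by
      simp only [Set.Finite.mem_toFinset, Set.mem_ofPred_eq, not_not] at hγ
      rw [inv_lt_inv₀ (by positivity) (by positivity)] at hγ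
      exact lt_of_pow_lt_pow_left₀ 3 hs.le hγ
    have hA := hCb _ hdet p.1 p.2 h1 h2 h3 h4
    rw [← jFac_mul_moeb_sub (jFac_ne_zero hdet (hε.trans_le h3))] at hA
    set A := ‖jFac (toRealM (γ : SL2Z)) p.1 * (moeb (toRealM (γ : SL2Z)) p.1 - p.2)‖
    have hA1 : 1 ≤ A := by
      by_contra! h
      nlinarith
    exact ⟨hA1, by nlinarith, hs⟩
  have hne : ∀ γ : Γ, γ ∉ hfin.toFinset → ∀ p ∈ K, moeb (toRealM (γ : SL2Z)) p.1 ≠ p.2 := by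
    intro γ hγ p hp h
    have := (hlower γ hγ p hp).1
    rw [h, sub_self, mul_zero, norm_zero] at this
    linarith
  refine ⟨hfin.toFinset, hne, ?_⟩
  refine .of_nonneg_of_le (fun γ => Real.iSup_nonneg fun p => norm_nonneg _) (fun γ => ?_)
    ((hsum.comp_injective (Subtype.val_injective (p := fun γ : Γ => γ ∉ hfin.toFinset))).mul_left
      (4 * M * M * (2 * C) ^ 3))
  refine Real.iSup_le (fun p => ?_) (by simp only [Function.comp_apply]; positivity)
  obtain ⟨⟨z, w⟩, hp⟩ := p
  obtain ⟨h1, h2, h3, h4⟩ := hb _ hp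
  obtain ⟨hA1, hsA, hs⟩ := hlower γ.1 γ.2 _ hp
  refine (norm_green_corner_le (det_toRealM _) k (hKH hp).1 (hKH hp).2
    (hne γ.1 γ.2 _ hp)).trans ?_
  simp only [Function.comp_apply] at *
  set A := ‖jFac (toRealM (γ.1 : SL2Z)) z * (moeb (toRealM (γ.1 : SL2Z)) z - w)‖
  set s := √(frobSq (toRealM (γ.1 : SL2Z)))
  have hz : z.im ≤ M := (le_abs_self _).trans ((abs_im_le_norm z).trans h1)
  have hw : w.im ≤ M := (le_abs_self _).trans ((abs_im_le_norm w).trans h2)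
  have hw0 : 0 ≤ w.im := hε.le.trans h4
  calc 4 * z.im * w.im / A ^ (k + 2) ≤ 4 * M * M / A ^ 3 := by
        gcongr
        · omega
    _ = 4 * M * M * (2 * C) ^ 3 * ((2 * C * A) ^ 3)⁻¹ := by
        have : A ≠ 0 := by positivity
        field_simp
    _ ≤ _ := by gcongr
end
end

section
/- Let w ∈ ℍ, let f : ℝ → ℂ be twice continuously differentiable, and define φ : ℍ∖{w} → ℂ by φ(ζ) = f(1 − 2·C(ζ,w)). Then for every z ∈ ℍ with z ≠ w, writing t = 1 − 2·C(z,w) (so t > 1) and y = Im z, one has −y²·(∂²φ/∂x²(z) + ∂²φ/∂y²(z)) = (1 − t²)·f''(t) − 2·t·f'(t). Consequently, for λ ∈ ℂ, the function φ satisfies −y²·(∂²φ/∂x² + ∂²φ/∂y²) + λ·φ = 0 at every point of ℍ∖{w} if and only if f satisfies the Legendre equation (1 − t²)·f''(t) − 2·t·f'(t) + λ·f(t) = 0 for every t > 1. -/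
/- STATEMENT 16: The correspondence between Laplace eigenfunctions of the form
`φ(ζ) = f(1 − 2C(ζ,w))` and solutions of Legendre's differential equation. -/

open Complex

noncomputable section

/-- Partial derivative in the `x` (real) direction of a function `ℂ → ℂ`. -/
def pdx (F : ℂ → ℂ) (z : ℂ) : ℂ := deriv (fun t : ℝ => F (z + (t : ℂ))) 0

/-- Partial derivative in the `y` (imaginary) direction of a function `ℂ → ℂ`. -/
def pdy (F : ℂ → ℂ) (z : ℂ) : ℂ := deriv (fun t : ℝ => F (z + (t : ℂ) * Complex.I)) 0

/-- The cross-ratio `C(z,w) = −|z−w|²/(4·Im(z)·Im(w))`, a non-positive real number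
for `z, w` in the upper half-plane. -/
def crossC (z w : ℂ) : ℝ := -(Complex.normSq (z - w)) / (4 * z.im * w.im)

/-- The function `ζ ↦ 1 - 2 C(ζ, w)` in real coordinates. -/
lemma one_sub_two_mul_crossC (w ζ : ℂ) (hw : 0 < w.im) (hζ : 0 < ζ.im) :
    1 - 2 * crossC ζ w =
      ((ζ.re - w.re) ^ 2 + ζ.im ^ 2 + w.im ^ 2) / (2 * ζ.im * w.im) := by
  have h1 := hw.ne'
  have h2 := hζ.ne'
  simp only [crossC, normSq_apply, sub_re, sub_im]
  field_simp
  ring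

lemma one_lt_one_sub_two_mul_crossC (w z : ℂ) (hw : 0 < w.im) (hz : 0 < z.im) (hzw : z ≠ w) :
    1 < 1 - 2 * crossC z w := by
  have h : 0 < normSq (z - w) := normSq_pos.mpr (sub_ne_zero.mpr hzw)
  have : 0 < normSq (z - w) / (4 * z.im * w.im) := by positivity
  rw [crossC, neg_div]
  linarith

lemma hasDerivAt_one_sub_two_mul_crossC_re (w ζ : ℂ) (hw : 0 < w.im) (hζ : 0 < ζ.im) :
    HasDerivAt (fun t : ℝ => 1 - 2 * crossC (ζ + t) w)
      ((ζ.re - w.re) / (ζ.im * w.im)) 0 := by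
  have e : (fun t : ℝ => 1 - 2 * crossC (ζ + t) w) = fun t : ℝ =>
      ((ζ.re + t - w.re) ^ 2 + ζ.im ^ 2 + w.im ^ 2) / (2 * ζ.im * w.im) := by
    funext t
    rw [one_sub_two_mul_crossC w _ hw (by simpa using hζ)]
    simp
  rw [e]
  have h := (((((hasDerivAt_id (0 : ℝ)).const_add ζ.re).sub_const w.re).pow 2).add_const
    (ζ.im ^ 2)).add_const (w.im ^ 2) |>.div_const (2 * ζ.im * w.im)
  refine HasDerivAt.congr_deriv h ?_
  have h1 := hw.ne'
  have h2 := hζ.ne'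
  simp
  field_simp

lemma hasDerivAt_one_sub_two_mul_crossC_im (w ζ : ℂ) (hw : 0 < w.im) (hζ : 0 < ζ.im) :
    HasDerivAt (fun t : ℝ => 1 - 2 * crossC (ζ + t * I) w)
      ((ζ.im ^ 2 - (ζ.re - w.re) ^ 2 - w.im ^ 2) / (2 * ζ.im ^ 2 * w.im)) 0 := by
  have e : (fun t : ℝ => 1 - 2 * crossC (ζ + t * I) w) =ᶠ[nhds 0] fun t : ℝ =>
      ((ζ.im + t) ^ 2 + ((ζ.re - w.re) ^ 2 + w.im ^ 2)) / (2 * w.im * (ζ.im + t)) := by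
    filter_upwards [lt_mem_nhds (neg_lt_zero.mpr hζ)] with t ht
    rw [one_sub_two_mul_crossC w _ hw (by simp; linarith)]
    simp
    ring
  refine HasDerivAt.congr_of_eventuallyEq ?_ e
  have h1 := hw.ne'
  have h2 := hζ.ne'
  have h0 := (hasDerivAt_id (0 : ℝ)).const_add ζ.im
  have h := ((h0.pow 2).add_const ((ζ.re - w.re) ^ 2 + w.im ^ 2)).div
    (h0.const_mul (2 * w.im)) (by simp [h1, h2])
  refine HasDerivAt.congr_deriv h ?_
  simp
  field_simp
  ring

/-- The second derivative of a composition `f ∘ T`, where `a` is the first derivative of `T`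
and `a'` is the derivative of `a`. -/
lemma hasDerivAt_deriv_comp {f : ℝ → ℂ} (hf : ContDiff ℝ 2 f) {T a : ℝ → ℝ} {a' x : ℝ}
    (hT : HasDerivAt T (a x) x) (ha : HasDerivAt a a' x) :
    HasDerivAt (fun t => (a t : ℂ) * deriv f (T t))
      ((a' : ℂ) * deriv f (T x) + (a x : ℂ) ^ 2 * deriv (deriv f) (T x)) x := by
  have hf' : Differentiable ℝ (deriv f) :=
    (hf.iterate_deriv' 1 1).differentiable one_ne_zero
  have h1 := ((hf' (T x)).hasDerivAt).scomp x hT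
  refine HasDerivAt.congr_deriv (ha.ofReal_comp.mul h1) ?_
  simp
  ring

lemma pdx_comp_crossC (w : ℂ) (hw : 0 < w.im) {f : ℝ → ℂ} (hf : Differentiable ℝ f)
    {φ : ℂ → ℂ} (hφ : ∀ ζ : ℂ, φ ζ = f (1 - 2 * crossC ζ w)) (ζ : ℂ) (hζ : 0 < ζ.im) :
    pdx φ ζ = (((ζ.re - w.re) / (ζ.im * w.im) : ℝ) : ℂ) * deriv f (1 - 2 * crossC ζ w) := by
  have h := HasDerivAt.scomp (0 : ℝ) (hf _).hasDerivAt
    (hasDerivAt_one_sub_two_mul_crossC_re w ζ hw hζ)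
  simp only [pdx, hφ]
  simpa [Function.comp_def] using h.deriv

lemma pdy_comp_crossC (w : ℂ) (hw : 0 < w.im) {f : ℝ → ℂ} (hf : Differentiable ℝ f)
    {φ : ℂ → ℂ} (hφ : ∀ ζ : ℂ, φ ζ = f (1 - 2 * crossC ζ w)) (ζ : ℂ) (hζ : 0 < ζ.im) :
    pdy φ ζ = (((ζ.im ^ 2 - (ζ.re - w.re) ^ 2 - w.im ^ 2) / (2 * ζ.im ^ 2 * w.im) : ℝ) : ℂ) *
      deriv f (1 - 2 * crossC ζ w) := by
  have h := HasDerivAt.scomp (0 : ℝ) (hf _).hasDerivAt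
    (hasDerivAt_one_sub_two_mul_crossC_im w ζ hw hζ)
  simp only [pdy, hφ]
  simpa [Function.comp_def] using h.deriv

lemma pdx_pdx_comp_crossC (w : ℂ) (hw : 0 < w.im) {f : ℝ → ℂ} (hf : ContDiff ℝ 2 f)
    {φ : ℂ → ℂ} (hφ : ∀ ζ : ℂ, φ ζ = f (1 - 2 * crossC ζ w)) (z : ℂ) (hz : 0 < z.im) :
    pdx (pdx φ) z = ((1 / (z.im * w.im) : ℝ) : ℂ) * deriv f (1 - 2 * crossC z w) +
      (((z.re - w.re) / (z.im * w.im) : ℝ) : ℂ) ^ 2 *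
        deriv (deriv f) (1 - 2 * crossC z w) := by
  have e : (fun t : ℝ => pdx φ (z + t)) = fun t : ℝ =>
      (((z.re + t - w.re) / (z.im * w.im) : ℝ) : ℂ) * deriv f (1 - 2 * crossC (z + t) w) := by
    funext t
    rw [pdx_comp_crossC w hw (hf.differentiable two_ne_zero) hφ _ (by simpa using hz)]
    simp
  rw [pdx, e]
  have ha : HasDerivAt (fun t : ℝ => (z.re + t - w.re) / (z.im * w.im)) (1 / (z.im * w.im)) 0 :=
    (((hasDerivAt_id (0 : ℝ)).const_add z.re).sub_const w.re).div_const _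
  have hT := hasDerivAt_one_sub_two_mul_crossC_re w z hw hz
  have h := hasDerivAt_deriv_comp hf (T := fun t : ℝ => 1 - 2 * crossC (z + t) w)
    (by simpa using hT) ha
  simpa using h.deriv

lemma pdy_pdy_comp_crossC (w : ℂ) (hw : 0 < w.im) {f : ℝ → ℂ} (hf : ContDiff ℝ 2 f)
    {φ : ℂ → ℂ} (hφ : ∀ ζ : ℂ, φ ζ = f (1 - 2 * crossC ζ w)) (z : ℂ) (hz : 0 < z.im) :
    pdy (pdy φ) z =
      ((((z.re - w.re) ^ 2 + w.im ^ 2) / (z.im ^ 3 * w.im) : ℝ) : ℂ) *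
        deriv f (1 - 2 * crossC z w) +
      (((z.im ^ 2 - (z.re - w.re) ^ 2 - w.im ^ 2) / (2 * z.im ^ 2 * w.im) : ℝ) : ℂ) ^ 2 *
        deriv (deriv f) (1 - 2 * crossC z w) := by
  have e : (fun t : ℝ => pdy φ (z + t * I)) =ᶠ[nhds 0] fun t : ℝ =>
      ((((z.im + t) ^ 2 - (z.re - w.re) ^ 2 - w.im ^ 2) / (2 * (z.im + t) ^ 2 * w.im) : ℝ) : ℂ) *
        deriv f (1 - 2 * crossC (z + t * I) w) := by
    filter_upwards [lt_mem_nhds (neg_lt_zero.mpr hz)] with t ht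
    rw [pdy_comp_crossC w hw (hf.differentiable two_ne_zero) hφ _ (by simp; linarith)]
    simp
  rw [pdy, e.deriv_eq]
  have h1 := hw.ne'
  have h2 := hz.ne'
  have ha : HasDerivAt (fun t : ℝ =>
      ((z.im + t) ^ 2 - (z.re - w.re) ^ 2 - w.im ^ 2) / (2 * (z.im + t) ^ 2 * w.im))
      (((z.re - w.re) ^ 2 + w.im ^ 2) / (z.im ^ 3 * w.im)) 0 := by
    have h0 := ((hasDerivAt_id (0 : ℝ)).const_add z.im).pow 2
    have h := ((h0.sub_const ((z.re - w.re) ^ 2)).sub_const (w.im ^ 2)).div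
      ((h0.const_mul 2).mul_const w.im) (by simp [h1, h2])
    refine HasDerivAt.congr_deriv h ?_
    simp
    field_simp
    ring
  have hT := hasDerivAt_one_sub_two_mul_crossC_im w z hw hz
  have h := hasDerivAt_deriv_comp hf (T := fun t : ℝ => 1 - 2 * crossC (z + t * I) w)
    (by simpa using hT) ha
  simpa using h.deriv

/-- The hyperbolic Laplacian of `ζ ↦ f (1 - 2 C(ζ, w))`. -/
lemma laplacian_comp_crossC (w : ℂ) (hw : 0 < w.im) {f : ℝ → ℂ} (hf : ContDiff ℝ 2 f)
    {φ : ℂ → ℂ} (hφ : ∀ ζ : ℂ, φ ζ = f (1 - 2 * crossC ζ w)) (z : ℂ) (hz : 0 < z.im) :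
    -((z.im : ℂ)) ^ 2 * (pdx (pdx φ) z + pdy (pdy φ) z) =
      ((1 - (1 - 2 * crossC z w) ^ 2 : ℝ) : ℂ) * deriv (deriv f) (1 - 2 * crossC z w) -
        2 * ((1 - 2 * crossC z w : ℝ) : ℂ) * deriv f (1 - 2 * crossC z w) := by
  rw [pdx_pdx_comp_crossC w hw hf hφ z hz, pdy_pdy_comp_crossC w hw hf hφ z hz]
  generalize hA : deriv (deriv f) (1 - 2 * crossC z w) = A
  generalize hB : deriv f (1 - 2 * crossC z w) = B
  rw [one_sub_two_mul_crossC w z hw hz]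
  have h1 : (w.im : ℂ) ≠ 0 := by exact_mod_cast hw.ne'
  have h2 : (z.im : ℂ) ≠ 0 := by exact_mod_cast hz.ne'
  push_cast
  field_simp
  ring

lemma exists_one_sub_two_mul_crossC_eq (w : ℂ) (hw : 0 < w.im) (t : ℝ) (ht : 1 < t) :
    ∃ z : ℂ, 0 < z.im ∧ z ≠ w ∧ 1 - 2 * crossC z w = t := by
  have hs : 0 < √(2 * (t - 1)) := Real.sqrt_pos.mpr (by linarith)
  have hs2 : √(2 * (t - 1)) ^ 2 = 2 * (t - 1) := Real.sq_sqrt (by linarith)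
  refine ⟨w + ((w.im * √(2 * (t - 1)) : ℝ) : ℂ), by simpa using hw, ?_, ?_⟩
  · rw [Ne, add_eq_left, ofReal_eq_zero]
    exact (mul_pos hw hs).ne'
  · have h1 := hw.ne'
    rw [one_sub_two_mul_crossC w _ hw (by simpa using hw)]
    simp only [add_re, ofReal_re, add_im, ofReal_im, add_zero, add_sub_cancel_left, mul_pow, hs2]
    field_simp
    ring

theorem statement_16 (w : ℂ) (hw : 0 < w.im) (f : ℝ → ℂ) (hf : ContDiff ℝ 2 f)
    (φ : ℂ → ℂ) (hφ : ∀ ζ : ℂ, φ ζ = f (1 - 2 * crossC ζ w)) (lam : ℂ) :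
    (∀ z : ℂ, 0 < z.im → z ≠ w →
      1 < 1 - 2 * crossC z w ∧
      -((z.im : ℂ)) ^ 2 * (pdx (pdx φ) z + pdy (pdy φ) z) =
        ((1 - (1 - 2 * crossC z w) ^ 2 : ℝ) : ℂ) * deriv (deriv f) (1 - 2 * crossC z w) -
          2 * ((1 - 2 * crossC z w : ℝ) : ℂ) * deriv f (1 - 2 * crossC z w)) ∧
    ((∀ z : ℂ, 0 < z.im → z ≠ w →
        -((z.im : ℂ)) ^ 2 * (pdx (pdx φ) z + pdy (pdy φ) z) + lam * φ z = 0) ↔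
      (∀ t : ℝ, 1 < t →
        ((1 - t ^ 2 : ℝ) : ℂ) * deriv (deriv f) t - 2 * (t : ℂ) * deriv f t + lam * f t = 0)) := by
  refine ⟨fun z hz hzw => ⟨one_lt_one_sub_two_mul_crossC w z hw hz hzw,
    laplacian_comp_crossC w hw hf hφ z hz⟩, fun h t ht => ?_, fun h z hz hzw => ?_⟩
  · obtain ⟨z, hz, hzw, rfl⟩ := exists_one_sub_two_mul_crossC_eq w hw t ht
    rw [← laplacian_comp_crossC w hw hf hφ z hz, ← hφ]
    exact h z hz hzw
  · rw [laplacian_comp_crossC w hw hf hφ z hz, hφ]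
    exact h _ (one_lt_one_sub_two_mul_crossC w z hw hz hzw)
end
end

section
/- Let m ≥ 0 be an integer, U ⊆ ℂ∖ℝ an open set, and H : U → ℂ a twice continuously differentiable function. Define φ : U → ℂ by φ(z) = (z − conj z)^{m}·H(z). Then (Δ_{m,m} + 2m)·H = 0 at every point of U if and only if (Δ_{0,0} + m·(m+1))·φ = 0 at every point of U. -/
/- STATEMENT 17: Correspondence between eigenfunctions of the weight-(m,m)
Laplacian and eigenfunctions of the classical hyperbolic Laplacian:
`(Δ_{m,m} + 2m)H = 0` iff `(Δ_{0,0} + m(m+1))((z − conj z)^m·H) = 0`. -/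

open Complex ComplexConjugate

noncomputable section

/-- Wirtinger derivative `∂F/∂z = (∂F/∂x − i·∂F/∂y)/2`. -/
def wdZ (F : ℂ → ℂ) (z : ℂ) : ℂ := (pdx F z - Complex.I * pdy F z) / 2

/-- Wirtinger derivative `∂F/∂z̄ = (∂F/∂x + i·∂F/∂y)/2`. -/
def wdZbar (F : ℂ → ℂ) (z : ℂ) : ℂ := (pdx F z + Complex.I * pdy F z) / 2

/-- Raising operator `∂_r F = (z − conj z)·∂F/∂z + r·F`. -/
def raiseOp (r : ℤ) (F : ℂ → ℂ) : ℂ → ℂ :=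
  fun z => (z - conj z) * wdZ F z + (r : ℂ) * F z

/-- Lowering operator `∂̄_s F = (conj z − z)·∂F/∂z̄ + s·F`. -/
def lowerOp (s : ℤ) (F : ℂ → ℂ) : ℂ → ℂ :=
  fun z => (conj z - z) * wdZbar F z + (s : ℂ) * F z

/-- The weight-(r,s) Laplacian `Δ_{r,s} = −∂̄_{s−1} ∘ ∂_r + r·(s−1)`. -/
def laplaceOp (r s : ℤ) (F : ℂ → ℂ) : ℂ → ℂ :=
  fun z => -(lowerOp (s - 1) (raiseOp r F) z) + ((r : ℂ) * ((s : ℂ) - 1)) * F z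

/-- A partial derivative along a line is the real Fréchet derivative in its direction. -/
theorem pdx_eq_fderiv {F : ℂ → ℂ} {z : ℂ} (hF : DifferentiableAt ℝ F z) :
    pdx F z = fderiv ℝ F z 1 := by
  have hl : HasDerivAt (fun t : ℝ => z + (t : ℂ)) 1 0 :=
    (Complex.ofRealCLM.hasDerivAt (x := 0)).const_add z
  have hF' : HasFDerivAt F (fderiv ℝ F z) (z + ((0 : ℝ) : ℂ)) := by
    simpa using hF.hasFDerivAt
  exact (hF'.comp_hasDerivAt (0 : ℝ) hl).deriv

theorem pdy_eq_fderiv {F : ℂ → ℂ} {z : ℂ} (hF : DifferentiableAt ℝ F z) :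
    pdy F z = fderiv ℝ F z I := by
  have hl : HasDerivAt (fun t : ℝ => z + (t : ℂ) * I) I 0 := by
    simpa using ((Complex.ofRealCLM.hasDerivAt (x := 0)).mul_const I).const_add z
  have hF' : HasFDerivAt F (fderiv ℝ F z) (z + ((0 : ℝ) : ℂ) * I) := by
    simpa using hF.hasFDerivAt
  exact (hF'.comp_hasDerivAt (0 : ℝ) hl).deriv

theorem wdZ_eq_fderiv {F : ℂ → ℂ} {z : ℂ} (hF : DifferentiableAt ℝ F z) :
    wdZ F z = (fderiv ℝ F z 1 - I * fderiv ℝ F z I) / 2 := by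
  rw [wdZ, pdx_eq_fderiv hF, pdy_eq_fderiv hF]

theorem wdZbar_eq_fderiv {F : ℂ → ℂ} {z : ℂ} (hF : DifferentiableAt ℝ F z) :
    wdZbar F z = (fderiv ℝ F z 1 + I * fderiv ℝ F z I) / 2 := by
  rw [wdZbar, pdx_eq_fderiv hF, pdy_eq_fderiv hF]

theorem wdZbar_congr {F G : ℂ → ℂ} {z : ℂ} (h : F =ᶠ[nhds z] G)
    (hF : DifferentiableAt ℝ F z) : wdZbar F z = wdZbar G z := by
  rw [wdZbar_eq_fderiv hF, wdZbar_eq_fderiv (h.differentiableAt_iff.mp hF), h.fderiv_eq]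

theorem hasFDerivAt_sub_conj_pow_mul (m : ℕ) {F : ℂ → ℂ} {z : ℂ}
    (hF : DifferentiableAt ℝ F z) :
    HasFDerivAt (fun ζ : ℂ => (ζ - conj ζ) ^ m * F ζ)
      ((z - conj z) ^ m • fderiv ℝ F z + F z • ((m * (z - conj z) ^ (m - 1)) •
        (ContinuousLinearMap.id ℝ ℂ - (conjCLE : ℂ →L[ℝ] ℂ)))) z := by
  have hw : HasFDerivAt (fun ζ : ℂ => ζ - conj ζ)
      (ContinuousLinearMap.id ℝ ℂ - (conjCLE : ℂ →L[ℝ] ℂ)) z :=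
    (hasFDerivAt_id z).sub (conjCLE : ℂ →L[ℝ] ℂ).hasFDerivAt
  have hp := hw.pow m
  rw [nsmul_eq_mul] at hp
  exact hp.mul hF.hasFDerivAt

theorem mul_natCast_mul_pow_pred (m : ℕ) (w : ℂ) : w * (m * w ^ (m - 1)) = m * w ^ m := by
  cases m with
  | zero => simp
  | succ k => rw [Nat.add_sub_cancel]; ring

/-- Product rule for `∂/∂z` against a power of `z - conj z`. -/
theorem sub_conj_mul_wdZ (m : ℕ) {F : ℂ → ℂ} {z : ℂ} (hF : DifferentiableAt ℝ F z) :
    (z - conj z) * wdZ (fun ζ : ℂ => (ζ - conj ζ) ^ m * F ζ) z =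
      (z - conj z) ^ m * ((z - conj z) * wdZ F z + m * F z) := by
  have h := hasFDerivAt_sub_conj_pow_mul m hF
  rw [wdZ_eq_fderiv h.differentiableAt, wdZ_eq_fderiv hF, h.fderiv]
  simp
  linear_combination F z * mul_natCast_mul_pow_pred m (z - conj z) -
    (z - conj z) * F z * m * (z - conj z) ^ (m - 1) * I_sq

/-- Product rule for `∂/∂z̄` against a power of `z - conj z`. -/
theorem sub_conj_mul_wdZbar (m : ℕ) {F : ℂ → ℂ} {z : ℂ} (hF : DifferentiableAt ℝ F z) :
    (z - conj z) * wdZbar (fun ζ : ℂ => (ζ - conj ζ) ^ m * F ζ) z =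
      (z - conj z) ^ m * ((z - conj z) * wdZbar F z - m * F z) := by
  have h := hasFDerivAt_sub_conj_pow_mul m hF
  rw [wdZbar_eq_fderiv h.differentiableAt, wdZbar_eq_fderiv hF, h.fderiv]
  simp
  linear_combination -F z * mul_natCast_mul_pow_pred m (z - conj z) +
    (z - conj z) * F z * m * (z - conj z) ^ (m - 1) * I_sq

theorem raiseOp_sub_conj_pow_mul (m : ℕ) {F : ℂ → ℂ} {z : ℂ}
    (hF : DifferentiableAt ℝ F z) :
    raiseOp 0 (fun ζ : ℂ => (ζ - conj ζ) ^ m * F ζ) z =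
      (z - conj z) ^ m * raiseOp m F z := by
  simp only [raiseOp, sub_conj_mul_wdZ m hF]
  push_cast
  ring

theorem differentiableAt_raiseOp (r : ℤ) {F : ℂ → ℂ} {z : ℂ} (hF : ContDiffAt ℝ 2 F z) :
    DifferentiableAt ℝ (raiseOp r F) z := by
  have hd : DifferentiableAt ℝ F z := hF.differentiableAt (by norm_num)
  have hf : DifferentiableAt ℝ (fderiv ℝ F) z :=
    (hF.fderiv_right (m := 1) (by norm_num)).differentiableAt (by norm_num)
  have hconj : DifferentiableAt ℝ (fun ζ : ℂ => conj ζ) z :=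
    (conjCLE : ℂ →L[ℝ] ℂ).differentiableAt
  have hev : raiseOp r F =ᶠ[nhds z] fun ζ =>
      (ζ - conj ζ) * ((fderiv ℝ F ζ 1 - I * fderiv ℝ F ζ I) / 2) + (r : ℂ) * F ζ := by
    filter_upwards [hF.eventually (by simp)] with ζ hζ
    rw [raiseOp, wdZ_eq_fderiv (hζ.differentiableAt (by norm_num))]
  refine hev.differentiableAt_iff.mpr ?_
  have h1 : DifferentiableAt ℝ (fun ζ => fderiv ℝ F ζ 1) z := hf.clm_apply (by fun_prop)
  have hI : DifferentiableAt ℝ (fun ζ => fderiv ℝ F ζ I) z := hf.clm_apply (by fun_prop)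
  fun_prop

/-- Multiplication by `(z - conj z) ^ m` intertwines `Δ_{m,m} + 2m` with `Δ_{0,0} + m(m+1)`. -/
theorem laplaceOp_sub_conj_pow_mul (m : ℕ) {H : ℂ → ℂ} {z : ℂ} (hH : ContDiffAt ℝ 2 H z) :
    laplaceOp 0 0 (fun ζ : ℂ => (ζ - conj ζ) ^ m * H ζ) z +
        (m : ℂ) * ((m : ℂ) + 1) * ((z - conj z) ^ m * H z) =
      (z - conj z) ^ m * (laplaceOp m m H z + 2 * (m : ℂ) * H z) := by
  have hG := differentiableAt_raiseOp m hH
  have hev : (fun ζ : ℂ => (ζ - conj ζ) ^ m * raiseOp m H ζ) =ᶠ[nhds z]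
      raiseOp 0 (fun ζ : ℂ => (ζ - conj ζ) ^ m * H ζ) := by
    filter_upwards [hH.eventually (by simp)] with ζ hζ
    exact (raiseOp_sub_conj_pow_mul m (hζ.differentiableAt (by norm_num))).symm
  have hbar := sub_conj_mul_wdZbar m hG
  rw [wdZbar_congr hev (hasFDerivAt_sub_conj_pow_mul m hG).differentiableAt] at hbar
  simp only [laplaceOp, lowerOp, ← hev.eq_of_nhds]
  push_cast
  linear_combination hbar

theorem statement_17 (m : ℕ) (U : Set ℂ) (hU : IsOpen U)
    (hUH : U ⊆ {z : ℂ | z.im ≠ 0})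
    (H : ℂ → ℂ) (hH : ContDiffOn ℝ 2 H U) :
    (∀ z ∈ U, laplaceOp (m : ℤ) (m : ℤ) H z + 2 * (m : ℂ) * H z = 0) ↔
    (∀ z ∈ U, laplaceOp 0 0 (fun ζ : ℂ => (ζ - conj ζ) ^ m * H ζ) z +
        (m : ℂ) * ((m : ℂ) + 1) * ((z - conj z) ^ m * H z) = 0) := by
  refine forall₂_congr fun z hz => ?_
  have hw : z - conj z ≠ 0 := fun h =>
    hUH hz (conj_eq_iff_im.mp (sub_eq_zero.mp h).symm)
  rw [laplaceOp_sub_conj_pow_mul m (hH.contDiffAt (hU.mem_nhds hz)), mul_eq_zero,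
    or_iff_right (pow_ne_zero m hw)]
end
end

section
/- Let Q : ℕ → ℝ → ℝ be a family of functions such that for all real t > 1: Q₀(t) = (1/2)·log((t+1)/(t−1)), Q₁(t) = (t/2)·log((t+1)/(t−1)) − 1, and (m+1)·Q_{m+1}(t) = (2m+1)·t·Q_m(t) − m·Q_{m−1}(t) for every m ≥ 1. Then for every m ≥ 0 and every t > 1, the (m+1)-st derivative of Q_m within the open interval (1,∞) satisfies Q_m^{(m+1)}(t) = 2^{m}·m!/(1 − t²)^{m+1}. -/
/- STATEMENT 18: For the Legendre functions of the second kind `Q_m`,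
characterized by their initial values and three-term recurrence, the
`(m+1)`-st derivative satisfies `Q_m^{(m+1)}(t) = 2^m·m!/(1 − t²)^{m+1}`. -/

noncomputable section

open Set

theorem ContDiffOn.hasDerivAt_iteratedDerivWithin {f : ℝ → ℝ} {s : Set ℝ} (hs : IsOpen s)
    (hf : ∀ n : ℕ, ContDiffOn ℝ n f s) (k : ℕ) {t : ℝ} (ht : t ∈ s) :
    HasDerivAt (iteratedDerivWithin k f s) (iteratedDerivWithin (k + 1) f s t) t := by
  rw [iteratedDerivWithin_succ]
  have h := (hf (k + 1)).differentiableOn_iteratedDerivWithin (m := k)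
    (by exact_mod_cast Nat.lt_succ_self k) hs.uniqueDiffOn
  exact (h t ht).hasDerivWithinAt.hasDerivAt (hs.mem_nhds ht)

theorem HasDerivAt.unique_of_eqOn {f g : ℝ → ℝ} {f' g' t : ℝ} {s : Set ℝ} (hs : IsOpen s)
    (ht : t ∈ s) (hf : HasDerivAt f f' t) (hg : HasDerivAt g g' t) (h : EqOn f g s) :
    f' = g' :=
  hf.unique (hg.congr_of_eventuallyEq (h.eventuallyEq_of_mem (hs.mem_nhds ht)))

theorem hasDerivAt_half_log_div {t : ℝ} (ht : 1 < t) :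
    HasDerivAt (fun t : ℝ => (1 / 2) * Real.log ((t + 1) / (t - 1))) (1 / (1 - t ^ 2)) t := by
  have h1 : t - 1 ≠ 0 := by linarith
  have h2 : t + 1 ≠ 0 := by linarith
  have h3 : 1 - t ^ 2 ≠ 0 := by nlinarith
  have h := ((((hasDerivAt_id t).add_const 1).div ((hasDerivAt_id t).sub_const 1) h1).log
    (div_ne_zero h2 h1)).const_mul (1 / 2)
  refine h.congr_deriv ?_
  simp only [id, Pi.div_apply]
  field_simp
  ring

/-- The three-term recurrence preserves smoothness. -/
theorem contDiffOn_of_legendre_recurrence (Q : ℕ → ℝ → ℝ)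
    (hQ0 : ∀ t : ℝ, 1 < t → Q 0 t = (1 / 2) * Real.log ((t + 1) / (t - 1)))
    (hQ1 : ∀ t : ℝ, 1 < t → Q 1 t = (t / 2) * Real.log ((t + 1) / (t - 1)) - 1)
    (hrec : ∀ m : ℕ, 1 ≤ m → ∀ t : ℝ, 1 < t →
      ((m : ℝ) + 1) * Q (m + 1) t = (2 * (m : ℝ) + 1) * t * Q m t - (m : ℝ) * Q (m - 1) t)
    (m n : ℕ) : ContDiffOn ℝ n (Q m) (Ioi 1) := by
  have hlog : ContDiffOn ℝ n (fun t : ℝ => Real.log ((t + 1) / (t - 1))) (Ioi 1) := by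
    have h1 : ∀ t ∈ Ioi (1 : ℝ), t - 1 ≠ 0 := fun t ht => (sub_pos.2 ht).ne'
    refine ContDiffOn.log (ContDiffOn.div (by fun_prop) (by fun_prop) h1) fun t ht => ?_
    have : t + 1 ≠ 0 := by
      rw [mem_Ioi] at ht
      linarith
    exact div_ne_zero this (h1 t ht)
  induction m using Nat.twoStepInduction with
  | zero => exact (contDiffOn_const.mul hlog).congr fun t ht => hQ0 t ht
  | one =>
    exact (((contDiffOn_id.div_const 2).mul hlog).sub contDiffOn_const).congr
      fun t ht => hQ1 t ht
  | more m ih0 ih1 =>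
    have h : ContDiffOn ℝ n (fun t : ℝ => ((2 * ((m + 1 : ℕ) : ℝ) + 1) * t * Q (m + 1) t
        - ((m + 1 : ℕ) : ℝ) * Q m t) / (((m + 1 : ℕ) : ℝ) + 1)) (Ioi 1) :=
      (((contDiffOn_const.mul contDiffOn_id).mul ih1).sub
        (contDiffOn_const.mul ih0)).div_const _
    refine h.congr fun t ht => ?_
    rw [eq_div_iff (by positivity), mul_comm]
    exact hrec (m + 1) (by omega) t ht

/-- The derivative relations `Q'ₘ₊₁ = t Q'ₘ + (m + 1) Qₘ` and `Q'ₘ = t Q'ₘ₊₁ - (m + 1) Qₘ₊₁`. -/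
theorem legendre_deriv_relations (Q Q' : ℕ → ℝ → ℝ)
    (hQ0 : ∀ t : ℝ, 1 < t → Q 0 t = (1 / 2) * Real.log ((t + 1) / (t - 1)))
    (hQ1 : ∀ t : ℝ, 1 < t → Q 1 t = (t / 2) * Real.log ((t + 1) / (t - 1)) - 1)
    (hrec : ∀ m : ℕ, 1 ≤ m → ∀ t : ℝ, 1 < t →
      ((m : ℝ) + 1) * Q (m + 1) t = (2 * (m : ℝ) + 1) * t * Q m t - (m : ℝ) * Q (m - 1) t)
    (hQ' : ∀ m t, 1 < t → HasDerivAt (Q m) (Q' m t) t) (m : ℕ) {t : ℝ} (ht : 1 < t) :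
    Q' (m + 1) t = t * Q' m t + (m + 1) * Q m t ∧
      Q' m t = t * Q' (m + 1) t - (m + 1) * Q (m + 1) t := by
  induction m with
  | zero =>
    have h0 : Q' 0 t = 1 / (1 - t ^ 2) :=
      (hQ' 0 t ht).unique_of_eqOn isOpen_Ioi ht (hasDerivAt_half_log_div ht) hQ0
    have hQ10 : ∀ t : ℝ, 1 < t → Q 1 t = t * Q 0 t - 1 := fun t ht => by
      rw [hQ0 t ht, hQ1 t ht]; ring
    have h1 : Q' 1 t = 1 * Q 0 t + t * Q' 0 t :=
      (hQ' 1 t ht).unique_of_eqOn isOpen_Ioi ht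
        (((hasDerivAt_id t).mul (hQ' 0 t ht)).sub_const 1) hQ10
    have h3 : 1 - t ^ 2 ≠ 0 := by nlinarith
    have h0' : (1 - t ^ 2) * Q' 0 t = 1 := by rw [h0]; field_simp
    simp only [zero_add, Nat.cast_zero]
    rw [h1, hQ10 t ht]
    exact ⟨by ring, by linear_combination h0'⟩
  | succ m ih =>
    obtain ⟨ih1, ih2⟩ := ih
    have hr := hrec (m + 1) (by omega)
    simp only [Nat.add_sub_cancel] at hr
    have hd := ((hQ' (m + 1 + 1) t ht).const_mul (((m + 1 : ℕ) : ℝ) + 1)).unique_of_eqOn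
      isOpen_Ioi ht
      ((((hasDerivAt_id t).const_mul (2 * ((m + 1 : ℕ) : ℝ) + 1)).mul (hQ' (m + 1) t ht)).sub
        ((hQ' m t ht).const_mul ((m + 1 : ℕ) : ℝ))) hr
    have hrt := hr t ht
    simp only [id] at hd
    push_cast at hd hrt ⊢
    have hm : (m : ℝ) + 1 + 1 ≠ 0 := by positivity
    have h1 : Q' (m + 1 + 1) t = t * Q' (m + 1) t + (m + 1 + 1) * Q (m + 1) t := by
      apply mul_left_cancel₀ hm
      linear_combination hd - (m + 1) * ih2
    refine ⟨h1, ?_⟩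
    linear_combination -t * h1 + hrt + ih1 + t * ih2

theorem statement_18 (Q : ℕ → ℝ → ℝ)
    (hQ0 : ∀ t : ℝ, 1 < t → Q 0 t = (1 / 2) * Real.log ((t + 1) / (t - 1)))
    (hQ1 : ∀ t : ℝ, 1 < t → Q 1 t = (t / 2) * Real.log ((t + 1) / (t - 1)) - 1)
    (hrec : ∀ m : ℕ, 1 ≤ m → ∀ t : ℝ, 1 < t →
      ((m : ℝ) + 1) * Q (m + 1) t = (2 * (m : ℝ) + 1) * t * Q m t - (m : ℝ) * Q (m - 1) t) :
    ∀ m : ℕ, ∀ t : ℝ, 1 < t →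
      iteratedDerivWithin (m + 1) (Q m) (Set.Ioi (1 : ℝ)) t =
        2 ^ m * (Nat.factorial m : ℝ) / (1 - t ^ 2) ^ (m + 1) := by
  have hD : ∀ m k t, 1 < t → HasDerivAt (iteratedDerivWithin k (Q m) (Ioi 1))
      (iteratedDerivWithin (k + 1) (Q m) (Ioi 1) t) t := fun m k t ht =>
    ContDiffOn.hasDerivAt_iteratedDerivWithin isOpen_Ioi
      (contDiffOn_of_legendre_recurrence Q hQ0 hQ1 hrec m) k ht
  have hD0 : ∀ m t, 1 < t → HasDerivAt (Q m) (iteratedDerivWithin 1 (Q m) (Ioi 1) t) t :=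
    fun m t ht => by simpa using hD m 0 t ht
  have hL : ∀ m k : ℕ, ∀ t : ℝ, 1 < t →
      iteratedDerivWithin (k + 1) (Q (m + 1)) (Ioi 1) t =
        t * iteratedDerivWithin (k + 1) (Q m) (Ioi 1) t +
          (m + 1 + k) * iteratedDerivWithin k (Q m) (Ioi 1) t := by
    intro m k
    induction k with
    | zero =>
      intro t ht
      simpa using (legendre_deriv_relations Q _ hQ0 hQ1 hrec hD0 m ht).1
    | succ k ih =>
      intro t ht
      have h := (hD (m + 1) (k + 1) t ht).unique_of_eqOn isOpen_Ioi ht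
        (((hasDerivAt_id t).mul (hD m (k + 1) t ht)).add ((hD m k t ht).const_mul _)) ih
      simp only [id] at h
      rw [h]
      push_cast
      ring
  intro m
  induction m with
  | zero =>
    intro t ht
    simpa using (hD0 0 t ht).unique_of_eqOn isOpen_Ioi ht (hasDerivAt_half_log_div ht) hQ0
  | succ m ih =>
    intro t ht
    have h3 : 1 - t ^ 2 ≠ 0 := by nlinarith
    have hbase : HasDerivAt (fun t : ℝ => 1 - t ^ 2) (-(2 * t)) t := by
      simpa using (hasDerivAt_pow 2 t).const_sub 1
    have h := (hD m (m + 1) t ht).unique_of_eqOn isOpen_Ioi ht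
      ((hasDerivAt_const t (2 ^ m * (Nat.factorial m : ℝ))).div (hbase.pow (m + 1))
        (pow_ne_zero _ h3)) ih
    rw [hL m (m + 1) t ht, ih t ht, h, Nat.factorial_succ]
    simp only [Pi.pow_apply, Nat.add_sub_cancel]
    push_cast
    field_simp
    ring
end
end
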